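/- arXiv:2410.03836 — 3 statements merged into one kernel-verified Lean document; each statement's English description precedes it below -/
import Mathlib

section
/- For any positive integers R and r, one has the identity ∑_{d | R} (|μ(d_{(r)})| / φ(d_{(r)})) · φ(d) = gcd(R, r) · W(gcd(R, R_{(r)})), where the sum runs over the positive divisors d of R. -/
/-- `W n` is the number of squarefree divisors of `n`. -/
def W (n : ℕ) : ℕ := (n.divisors.filter Squarefree).card

theorem W_eq_two_pow_card_primeFactors {n : ℕ} (hn : n ≠ 0) : W n = 2 ^ n.primeFactors.card := by
  have h := Nat.sum_divisors_filter_squarefree hn (f := fun _ ↦ (1 : ℕ))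
  simp only [Finset.sum_const, smul_eq_mul, mul_one, Finset.card_powerset] at h
  rw [W, h, Nat.factors_eq]
  rfl

theorem W_mul_of_coprime {m n : ℕ} (h : m.Coprime n) (hm : m ≠ 0) (hn : n ≠ 0) :
    W (m * n) = W m * W n := by
  rw [W_eq_two_pow_card_primeFactors hm, W_eq_two_pow_card_primeFactors hn,
    W_eq_two_pow_card_primeFactors (mul_ne_zero hm hn), h.primeFactors_mul,
    Finset.card_union_of_disjoint h.disjoint_primeFactors, pow_add]

theorem div_gcd_ne_zero {a : ℕ} (ha : a ≠ 0) (r : ℕ) : a / a.gcd r ≠ 0 :=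
  (Nat.div_gcd_pos_of_pos_left r (Nat.pos_of_ne_zero ha)).ne'

theorem coprime_div_gcd_div_gcd {a b : ℕ} (h : a.Coprime b) (r : ℕ) :
    (a / a.gcd r).Coprime (b / b.gcd r) :=
  (h.coprime_dvd_left (Nat.div_dvd_of_dvd (a.gcd_dvd_left r))).coprime_dvd_right
    (Nat.div_dvd_of_dvd (b.gcd_dvd_left r))

theorem gcd_mul_left_of_coprime {a b : ℕ} (h : a.Coprime b) (r : ℕ) :
    (a * b).gcd r = a.gcd r * b.gcd r := by
  rw [Nat.gcd_comm, h.gcd_mul, Nat.gcd_comm r a, Nat.gcd_comm r b]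

theorem mul_div_gcd_of_coprime {a b : ℕ} (h : a.Coprime b) (r : ℕ) :
    a * b / (a * b).gcd r = (a / a.gcd r) * (b / b.gcd r) := by
  rw [gcd_mul_left_of_coprime h,
    Nat.mul_div_mul_comm (a.gcd_dvd_left r) (b.gcd_dvd_left r)]

/-- The summand of `moebius_totient_divisor_sum`, as an arithmetic function of `d`. -/
def moebiusTotientTerm (r : ℕ) : ArithmeticFunction ℚ where
  toFun d := |(ArithmeticFunction.moebius (d / d.gcd r) : ℚ)| / (Nat.totient (d / d.gcd r) : ℚ) *
    (Nat.totient d : ℚ)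
  map_zero' := by simp

theorem moebiusTotientTerm_apply (r d : ℕ) : moebiusTotientTerm r d =
    |(ArithmeticFunction.moebius (d / d.gcd r) : ℚ)| / (Nat.totient (d / d.gcd r) : ℚ) *
      (Nat.totient d : ℚ) := rfl

theorem isMultiplicative_moebiusTotientTerm (r : ℕ) :
    (moebiusTotientTerm r).IsMultiplicative := by
  refine ArithmeticFunction.IsMultiplicative.iff_ne_zero.2
    ⟨by simp [moebiusTotientTerm_apply], fun {m n} _ _ h ↦ ?_⟩
  have hq := coprime_div_gcd_div_gcd h r
  simp only [moebiusTotientTerm_apply, mul_div_gcd_of_coprime h,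
    ArithmeticFunction.isMultiplicative_moebius.map_mul_of_coprime hq,
    Nat.totient_mul hq, Nat.totient_mul h]
  push_cast
  rw [abs_mul]
  ring

/-- The function `n ↦ gcd(n, r) · W(n / gcd(n, r))`. -/
def gcdMulW (r : ℕ) : ArithmeticFunction ℚ where
  toFun n := (n.gcd r : ℚ) * (W (n / n.gcd r) : ℚ)
  map_zero' := by simp [W]

theorem gcdMulW_apply (r n : ℕ) : gcdMulW r n = (n.gcd r : ℚ) * (W (n / n.gcd r) : ℚ) := rfl

theorem isMultiplicative_gcdMulW (r : ℕ) : (gcdMulW r).IsMultiplicative := by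
  refine ArithmeticFunction.IsMultiplicative.iff_ne_zero.2
    ⟨by simp [gcdMulW_apply, W_eq_two_pow_card_primeFactors], fun {m n} hm hn h ↦ ?_⟩
  simp only [gcdMulW_apply, mul_div_gcd_of_coprime h,
    W_mul_of_coprime (coprime_div_gcd_div_gcd h r) (div_gcd_ne_zero hm r) (div_gcd_ne_zero hn r)]
  rw [gcd_mul_left_of_coprime h]
  push_cast
  ring

theorem gcd_prime_pow_pow_mul {p m : ℕ} (hp : p.Prime) (hm : ¬ p ∣ m) (n b : ℕ) :
    (p ^ n).gcd (p ^ b * m) = p ^ min n b := by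
  rw [Nat.Coprime.gcd_mul_right_cancel_right _ (((hp.coprime_iff_not_dvd.2 hm).pow_left n).symm)]
  rcases le_total n b with h | h
  · rw [min_eq_left h, Nat.gcd_eq_left (pow_dvd_pow p h)]
  · rw [min_eq_right h, Nat.gcd_eq_right (pow_dvd_pow p h)]

theorem prime_pow_div_gcd {p m : ℕ} (hp : p.Prime) (hm : ¬ p ∣ m) (n b : ℕ) :
    p ^ n / (p ^ n).gcd (p ^ b * m) = p ^ (n - b) := by
  rw [gcd_prime_pow_pow_mul hp hm, Nat.pow_div (min_le_left n b) hp.pos]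
  congr 1
  omega

theorem sum_moebiusTotientTerm_prime_pow {p m : ℕ} (hp : p.Prime) (hm : ¬ p ∣ m) (n b : ℕ) :
    ∑ i ∈ Finset.range (n + 1), moebiusTotientTerm (p ^ b * m) (p ^ i) =
      gcdMulW (p ^ b * m) (p ^ n) := by
  have hp1 : (p : ℚ) - 1 ≠ 0 := sub_ne_zero.2 (by exact_mod_cast hp.one_lt.ne')
  have hW (k : ℕ) : W (p ^ (k + 1)) = 2 := by
    rw [W_eq_two_pow_card_primeFactors (pow_ne_zero _ hp.ne_zero),
      Nat.primeFactors_prime_pow k.succ_ne_zero hp, Finset.card_singleton, pow_one]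
  have hW1 : W 1 = 1 := by simp [W_eq_two_pow_card_primeFactors]
  induction n with
  | zero => simp [moebiusTotientTerm_apply, gcdMulW_apply, hW1]
  | succ n ih =>
    rw [Finset.sum_range_succ, ih]
    simp only [moebiusTotientTerm_apply, gcdMulW_apply, prime_pow_div_gcd hp hm]
    simp only [gcd_prime_pow_pow_mul hp hm]
    have htot (k : ℕ) : (Nat.totient (p ^ (k + 1)) : ℚ) = (p : ℚ) ^ k * (p - 1) := by
      rw [Nat.totient_prime_pow_succ hp]
      push_cast [hp.one_le]
      ring
    rcases lt_trichotomy n b with h | rfl | h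
    · rw [Nat.sub_eq_zero_of_le h.le, Nat.sub_eq_zero_of_le h, min_eq_left h.le, min_eq_left h,
        htot]
      simp [hW1]
      ring
    · have h1 := hW 0
      rw [zero_add, pow_one] at h1
      simp [hW1, h1, htot, ArithmeticFunction.moebius_apply_prime hp, Nat.totient_prime hp,
        Nat.cast_sub hp.one_le]
      field_simp
      ring
    · obtain ⟨k, rfl⟩ := Nat.exists_eq_add_of_lt h
      rw [min_eq_right (by omega), min_eq_right (by omega),
        show b + k + 1 - b = k + 1 by omega, show b + k + 1 + 1 - b = k + 1 + 1 by omega,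
        hW, hW, ArithmeticFunction.moebius_apply_prime_pow hp (by omega)]
      simp

theorem moebiusTotientTerm_mul_zeta {r : ℕ} (hr : 0 < r) :
    moebiusTotientTerm r * (ArithmeticFunction.zeta : ArithmeticFunction ℚ) = gcdMulW r := by
  refine ((isMultiplicative_moebiusTotientTerm r).mul
    ArithmeticFunction.isMultiplicative_zeta.natCast).eq_iff_eq_on_prime_powers _ _
      (isMultiplicative_gcdMulW r) |>.2 fun p n hp ↦ ?_
  obtain ⟨b, m, hm, rfl⟩ := Nat.exists_eq_pow_mul_and_not_dvd hr.ne' p hp.ne_one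
  rw [ArithmeticFunction.coe_mul_zeta_apply, Nat.sum_divisors_prime_pow hp,
    sum_moebiusTotientTerm_prime_pow hp hm]

/-- For any positive integers `R` and `r`,
`∑_{d ∣ R} (|μ(d_{(r)})| / φ(d_{(r)})) · φ(d) = gcd(R, r) · W(gcd(R, R_{(r)}))`,
where `a_{(b)} = a / gcd(a, b)`. -/
theorem moebius_totient_divisor_sum (R r : ℕ) (hR : 0 < R) (hr : 0 < r) :
    ∑ d ∈ R.divisors,
      (|(ArithmeticFunction.moebius (d / Nat.gcd d r) : ℚ)| /
          (Nat.totient (d / Nat.gcd d r) : ℚ)) * (Nat.totient d : ℚ)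
      = (Nat.gcd R r : ℚ) * (W (Nat.gcd R (R / Nat.gcd R r)) : ℚ) := by
  have h := congrArg (· R) (moebiusTotientTerm_mul_zeta hr)
  simp only [ArithmeticFunction.coe_mul_zeta_apply, gcdMulW_apply, moebiusTotientTerm_apply] at h
  rw [h, Nat.gcd_eq_right (Nat.div_dvd_of_dvd (R.gcd_dvd_left r))]
end

section
/- Let q be a prime power, r a positive divisor of q−1, and R a positive divisor of (q−1)/r. Then for every α ∈ F_q^*, the quantity (θ(R)/r) · ∑_{d | Rr} (μ(d_{(r)})/φ(d_{(r)})) · ∑_{χ_d} χ_d(α), where θ(R) = φ(R)/R, d_{(r)} = d/gcd(d,r), and the inner sum runs over all multiplicative characters χ_d of F_q of order exactly d, equals 1 if α is (R, r)-free and equals 0 otherwise. -/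
open scoped Classical

noncomputable instance {F : Type*} [Field F] [Fintype F] : Fintype (MulChar F ℂ) :=
  Fintype.ofFinite _

/-- For `r ∣ q - 1` and `R ∣ (q-1)/r`, an element `α ∈ F_q^*` is `(R, r)`-free if it lies in the
subgroup `C_r = {x : x ^ ((q-1)/r) = 1}` of order `(q-1)/r` and cannot be written as `β ^ s`
for any `β ∈ C_r` and any divisor `s > 1` of `R`. -/
def IsRrFree {F : Type*} [Field F] [Fintype F] (R r : ℕ) (α : Fˣ) : Prop :=
  α ^ ((Fintype.card F - 1) / r) = 1 ∧
    ¬ ∃ (β : Fˣ) (s : ℕ), β ^ ((Fintype.card F - 1) / r) = 1 ∧ s ∣ R ∧ 1 < s ∧ α = β ^ s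

open ArithmeticFunction in
theorem sum_divisors_moebius_div {n : ℕ} (hn : 0 < n) :
    ∑ d ∈ n.divisors, (moebius d : ℂ) / d = (n.totient : ℂ) / n := by
  have h := (sum_eq_iff_sum_mul_moebius_eq (R := ℂ) (f := fun k => (k.totient : ℂ))
    (g := fun k => (k : ℂ))).1 (fun k _ => by exact_mod_cast k.sum_totient) n hn
  rw [← h, Nat.sum_divisorsAntidiagonal (fun a b => (moebius a : ℂ) * (b : ℂ)), Finset.sum_div]
  refine Finset.sum_congr rfl fun d hd => ?_
  have hdn := Nat.dvd_of_mem_divisors hd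
  have hd0 : (d : ℂ) ≠ 0 := by exact_mod_cast (Nat.pos_of_mem_divisors hd).ne'
  have hn0 : (n : ℂ) ≠ 0 := by exact_mod_cast hn.ne'
  rw [Nat.cast_div hdn hd0]
  field_simp

theorem Nat.totient_div_self_eq_of_primeFactors_eq {m n : ℕ} (hm : 0 < m) (hn : 0 < n)
    (h : m.primeFactors = n.primeFactors) : (m.totient : ℂ) / m = (n.totient : ℂ) / n := by
  have key : ∀ k : ℕ, 0 < k →
      (k.totient : ℂ) / k = ((∏ p ∈ k.primeFactors, (1 - (p : ℚ)⁻¹) : ℚ) : ℂ) := by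
    intro k hk
    have hk0 : (k : ℂ) ≠ 0 := by exact_mod_cast hk.ne'
    rw [div_eq_iff hk0, mul_comm]
    exact_mod_cast Nat.totient_eq_mul_prod_factors k
  rw [key m hm, key n hn, h]

open UniqueFactorizationMonoid (radical squarefree_radical dvd_radical_iff radical_dvd_self) in
open ArithmeticFunction in
theorem sum_divisors_moebius_div_of_dvd {R d : ℕ} (hR : 0 < R) (hd : d ∣ R) :
    ∑ e ∈ R.divisors with d ∣ e, (moebius e : ℂ) / e =
      (R.totient : ℂ) / R * ((moebius d : ℂ) / d.totient) := by
  by_cases hsq : Squarefree d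
  swap
  · rw [moebius_eq_zero_of_not_squarefree hsq]
    refine (Finset.sum_eq_zero fun e he => ?_).trans (by simp)
    have : ¬ Squarefree e := fun h => hsq (h.squarefree_of_dvd (Finset.mem_filter.1 he).2)
    simp [moebius_eq_zero_of_not_squarefree this]
  obtain ⟨m, hm⟩ : d ∣ radical R := (dvd_radical_iff hsq.isRadical hR.ne').2 hd
  have hrad : Squarefree (d * m) := hm ▸ squarefree_radical
  have hdm : d.Coprime m := Nat.coprime_of_squarefree_mul hrad
  have hdm0 : 0 < d * m := Nat.pos_of_ne_zero hrad.ne_zero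
  have hd0 : 0 < d := pos_of_mul_pos_left hdm0 (Nat.zero_le _)
  have hm0 : 0 < m := pos_of_mul_pos_right hdm0 (Nat.zero_le _)
  have hθ : (R.totient : ℂ) / R = (d.totient : ℂ) / d * ((m.totient : ℂ) / m) := by
    rw [← Nat.totient_div_self_eq_of_primeFactors_eq (hm ▸ hdm0) hR (Nat.primeFactors_radical R),
      hm, Nat.totient_mul hdm]
    push_cast
    rw [mul_div_mul_comm]
  have hφ : (d.totient : ℂ) ≠ 0 := by exact_mod_cast (Nat.totient_pos.2 hd0).ne'
  calc ∑ e ∈ R.divisors with d ∣ e, (moebius e : ℂ) / e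
      = ∑ e ∈ m.divisors.image (d * ·), (moebius e : ℂ) / e := by
        symm
        refine Finset.sum_subset (fun e he => ?_) fun e he he' => ?_
        · obtain ⟨f, hf, rfl⟩ := Finset.mem_image.1 he
          refine Finset.mem_filter.2 ⟨Nat.mem_divisors.2 ⟨?_, hR.ne'⟩, dvd_mul_right _ _⟩
          exact (mul_dvd_mul_left d (Nat.dvd_of_mem_divisors hf)).trans (hm ▸ radical_dvd_self)
        · obtain ⟨heR, f, rfl⟩ := Finset.mem_filter.1 he
          suffices ¬ Squarefree (d * f) by simp [moebius_eq_zero_of_not_squarefree this]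
          intro h
          have h1 := (dvd_radical_iff h.isRadical hR.ne').2 (Nat.dvd_of_mem_divisors heR)
          rw [hm] at h1
          exact he' (Finset.mem_image_of_mem _
            (Nat.mem_divisors.2 ⟨Nat.dvd_of_mul_dvd_mul_left hd0 h1, hm0.ne'⟩))
    _ = ∑ f ∈ m.divisors, (moebius d : ℂ) / d * ((moebius f : ℂ) / f) := by
        rw [Finset.sum_image fun a _ b _ h => Nat.eq_of_mul_eq_mul_left hd0 h]
        refine Finset.sum_congr rfl fun f hf => ?_
        have hdf := hdm.coprime_dvd_right (Nat.dvd_of_mem_divisors hf)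
        rw [isMultiplicative_moebius.map_mul_of_coprime hdf]
        push_cast
        rw [mul_div_mul_comm]
    _ = _ := by
        rw [← Finset.mul_sum, sum_divisors_moebius_div hm0, hθ]
        field_simp

theorem MulChar.sum_pow_eq_one {F : Type*} [Field F] [Fintype F] {m k : ℕ}
    (hmk : Fintype.card F - 1 = m * k) (α : Fˣ) :
    ∑ χ : MulChar F ℂ with χ ^ m = 1, χ (α : F) = if α ^ k = 1 then (m : ℂ) else 0 := by
  have hcard : Nat.card Fˣ = m * k := by
    rw [Nat.card_eq_fintype_card, Fintype.card_units, hmk]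
  split_ifs with h
  · obtain ⟨β, rfl⟩ : ∃ β : Fˣ, β ^ m = α := by
      obtain ⟨g, hg⟩ := IsCyclic.exists_zpow_surjective (G := Fˣ)
      obtain ⟨a, rfl⟩ := hg α
      have ho : orderOf g = m * k := by
        rw [← hcard]; exact orderOf_eq_card_of_forall_mem_zpowers hg
      have hk : (k : ℤ) ≠ 0 := by
        have : 0 < m * k := hcard ▸ Nat.card_pos
        exact_mod_cast (pos_of_mul_pos_right this (Nat.zero_le _)).ne'
      rw [← zpow_natCast, ← zpow_mul, ← orderOf_dvd_iff_zpow_eq_one, ho, Nat.cast_mul] at h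
      obtain ⟨b, rfl⟩ := Int.dvd_of_mul_dvd_mul_right hk h
      exact ⟨g ^ b, by rw [← zpow_natCast, ← zpow_mul, mul_comm]⟩
    have h1 : ∀ χ ∈ (Finset.univ.filter fun χ : MulChar F ℂ => χ ^ m = 1),
        χ ((β ^ m : Fˣ) : F) = 1 := by
      intro χ hχ
      rw [Units.val_pow_eq_pow_val, map_pow, ← MulChar.pow_apply_coe,
        (Finset.mem_filter.1 hχ).2, MulChar.one_apply_coe]
    rw [Finset.sum_congr rfl h1, Finset.sum_const, nsmul_one]
    obtain ⟨e⟩ := MulChar.mulEquiv_units F ℂ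
    have : IsCyclic (MulChar F ℂ) := e.isCyclic.2 inferInstance
    have hker := IsCyclic.card_powMonoidHom_ker (MulChar F ℂ) m
    rw [Nat.card_congr e.toEquiv, hcard, Nat.gcd_mul_right_left] at hker
    refine congrArg Nat.cast (Eq.trans ?_ hker)
    rw [Nat.card_eq_fintype_card, Fintype.card_subtype]
    simp [MonoidHom.mem_ker]
  · obtain ⟨ψ, hψ⟩ := MulChar.exists_apply_ne_one_of_hasEnoughRootsOfUnity F ℂ
      (a := ((α ^ k : Fˣ) : F)) (by rwa [Ne, Units.val_eq_one])
    have hψm : (ψ ^ k) ^ m = 1 := by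
      rw [← pow_mul, mul_comm k m, ← hmk, ← Fintype.card_units]
      exact MulChar.pow_card_eq_one ψ
    have hψα : (ψ ^ k) (α : F) ≠ 1 := by
      rwa [MulChar.pow_apply_coe, ← map_pow, ← Units.val_pow_eq_pow_val]
    refine eq_zero_of_mul_eq_self_left hψα ?_
    rw [Finset.mul_sum]
    refine Finset.sum_equiv (Equiv.mulLeft (ψ ^ k)) (fun χ => ?_) fun χ _ => ?_
    · simp [mul_pow, hψm]
    · simp [MulChar.mul_apply]

theorem MulChar.sum_divisors_sum_orderOf_eq {F : Type*} [Field F] [Fintype F] {m : ℕ}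
    (hm : 0 < m) (f : MulChar F ℂ → ℂ) :
    ∑ d ∈ m.divisors, ∑ χ : MulChar F ℂ with orderOf χ = d, f χ =
      ∑ χ : MulChar F ℂ with χ ^ m = 1, f χ := by
  rw [← Finset.sum_fiberwise_of_maps_to (g := orderOf) (t := m.divisors) fun χ hχ =>
    Nat.mem_divisors.2 ⟨orderOf_dvd_of_pow_eq_one (Finset.mem_filter.1 hχ).2, hm.ne'⟩]
  refine Finset.sum_congr rfl fun d hd => Finset.sum_congr ?_ fun _ _ => rfl
  ext χ
  simp only [Finset.mem_filter, Finset.mem_univ, true_and]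
  refine ⟨fun h => ⟨orderOf_dvd_iff_pow_eq_one.1 (h ▸ Nat.dvd_of_mem_divisors hd), h⟩, And.right⟩

theorem pow_pow_eq_one_iff_dvd {G : Type*} [Monoid G] {g : G} {m k : ℕ} (hk : 0 < k)
    (hg : orderOf g = m * k) (a : ℕ) : (g ^ a) ^ k = 1 ↔ m ∣ a := by
  rw [← pow_mul, ← orderOf_dvd_iff_pow_eq_one, hg, Nat.mul_dvd_mul_iff_right hk]

theorem isRrFree_pow_iff {F : Type*} [Field F] [Fintype F] {r R k : ℕ} (hr : 0 < r)
    (hR : 0 < R) (hk : 0 < k) (hcard : Fintype.card F - 1 = r * (R * k)) {g : Fˣ}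
    (ho : orderOf g = r * (R * k)) (a : ℕ) :
    IsRrFree R r (g ^ a) ↔ ∃ b, a = r * b ∧ R.gcd b = 1 := by
  have hRk : 0 < R * k := Nat.mul_pos hR hk
  rw [IsRrFree, hcard, Nat.mul_div_cancel_left _ hr, pow_pow_eq_one_iff_dvd hRk ho]
  constructor
  · rintro ⟨⟨b, rfl⟩, h⟩
    refine ⟨b, rfl, ?_⟩
    by_contra hne
    have hs : 0 < R.gcd b := Nat.gcd_pos_of_pos_left _ hR
    obtain ⟨c, hc⟩ := Nat.gcd_dvd_right R b
    refine h ⟨g ^ (r * c), R.gcd b, ?_, Nat.gcd_dvd_left R b, by omega, ?_⟩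
    · exact (pow_pow_eq_one_iff_dvd hRk ho _).2 (dvd_mul_right _ _)
    · rw [← pow_mul, mul_assoc, mul_comm c, ← hc]
  · rintro ⟨b, rfl, hb⟩
    refine ⟨dvd_mul_right _ _, ?_⟩
    rintro ⟨β, s, hβ, ⟨t, rfl⟩, hs, hα⟩
    have htk : 0 < t * k := by
      rw [mul_assoc] at hRk
      exact pos_of_mul_pos_right hRk (Nat.zero_le _)
    have h1 : r * s ∣ r * b := by
      rw [← pow_pow_eq_one_iff_dvd (g := g) htk (by rw [ho]; ring), hα, ← pow_mul, ← mul_assoc]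
      exact hβ
    have h2 : s ∣ (s * t).gcd b :=
      Nat.dvd_gcd (dvd_mul_right _ _) (Nat.dvd_of_mul_dvd_mul_left hr h1)
    rw [hb, Nat.dvd_one] at h2
    omega

open ArithmeticFunction in
theorem sum_divisors_moebius_ite_dvd {r R : ℕ} (hr : 0 < r) (hR : 0 < R) (a : ℕ) :
    ∑ e ∈ R.divisors, (if r * e ∣ a then (moebius e : ℂ) else 0) =
      if ∃ b, a = r * b ∧ R.gcd b = 1 then 1 else 0 := by
  by_cases hra : r ∣ a
  · obtain ⟨b, rfl⟩ := hra
    have h1 : R.divisors.filter (fun e => r * e ∣ r * b) = (R.gcd b).divisors := by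
      ext e
      simp [Nat.mul_dvd_mul_iff_left hr, Nat.dvd_gcd_iff, hR.ne']
    have h2 : (∃ b', r * b = r * b' ∧ R.gcd b' = 1) ↔ R.gcd b = 1 :=
      ⟨fun ⟨b', h, h'⟩ => Nat.eq_of_mul_eq_mul_left hr h ▸ h', fun h => ⟨b, rfl, h⟩⟩
    have h3 := congrArg (fun f : ArithmeticFunction ℤ => f (R.gcd b)) moebius_mul_coe_zeta
    simp only [coe_mul_zeta_apply, one_apply] at h3
    rw [← Finset.sum_filter, h1]
    simp only [h2]
    exact_mod_cast congrArg (Int.cast : ℤ → ℂ) h3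
  · rw [if_neg fun ⟨b, hb, _⟩ => hra ⟨b, hb⟩]
    exact Finset.sum_eq_zero fun e _ => if_neg fun h => hra ((dvd_mul_right r e).trans h)

theorem Nat.div_gcd_dvd_iff {d r e : ℕ} (hr : 0 < r) : d / d.gcd r ∣ e ↔ d ∣ r * e := by
  have hg : 0 < d.gcd r := Nat.gcd_pos_of_pos_right _ hr
  obtain ⟨d', hd'⟩ := Nat.gcd_dvd_left d r
  have hdd : d / d.gcd r = d' := Nat.div_eq_of_eq_mul_right hg hd'
  refine ⟨fun h => ?_, fun h => ?_⟩
  · rw [hdd] at h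
    rw [hd']
    exact mul_dvd_mul (Nat.gcd_dvd_right _ _) h
  · have hc := Nat.coprime_div_gcd_div_gcd hg
    refine hc.dvd_of_dvd_mul_left (Nat.dvd_of_mul_dvd_mul_left hg ?_)
    rwa [Nat.mul_div_cancel' (Nat.gcd_dvd_left d r), ← mul_assoc,
      Nat.mul_div_cancel' (Nat.gcd_dvd_right d r)]

/-- **Characteristic function of `(R, r)`-free elements** (Cohen–Kapetanakis–Reis).
For a prime power `q`, a positive divisor `r` of `q - 1`, a positive divisor `R` of `(q-1)/r`
and `α ∈ F_q^*`, `(φ(R)/(R·r)) · ∑_{d ∣ Rr} (μ(d_{(r)})/φ(d_{(r)})) · ∑_{χ of order d} χ(α)`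
equals `1` if `α` is `(R, r)`-free and `0` otherwise, where `d_{(r)} = d / gcd(d, r)`. -/
theorem rrFree_characteristic_function
    {F : Type*} [Field F] [Fintype F] {q : ℕ} (hq : Fintype.card F = q)
    (r R : ℕ) (hr : 0 < r) (hrq : r ∣ q - 1) (hR : 0 < R) (hRq : R ∣ (q - 1) / r) (α : Fˣ) :
    ((Nat.totient R : ℂ) / (R : ℂ)) / (r : ℂ) *
      ∑ d ∈ (R * r).divisors,
        ((ArithmeticFunction.moebius (d / Nat.gcd d r) : ℂ) /
            (Nat.totient (d / Nat.gcd d r) : ℂ)) *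
          ∑ χ ∈ Finset.univ.filter (fun χ : MulChar F ℂ => orderOf χ = d), χ (α : F)
      = if IsRrFree R r α then 1 else 0 := by
  subst hq
  have hcard0 : 0 < Fintype.card F - 1 := Nat.sub_pos_of_lt Fintype.one_lt_card
  obtain ⟨k, hk⟩ := hRq
  have hcard : Fintype.card F - 1 = r * (R * k) := by rw [← hk, Nat.mul_div_cancel' hrq]
  have hk0 : 0 < k := by
    rw [hcard, ← mul_assoc] at hcard0
    exact pos_of_mul_pos_right hcard0 (Nat.zero_le _)
  obtain ⟨g, hg⟩ := IsCyclic.exists_monoid_generator (α := Fˣ)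
  have ho : orderOf g = r * (R * k) := by
    rw [← hcard, ← Fintype.card_units, ← Nat.card_eq_fintype_card]
    exact orderOf_eq_card_of_forall_mem_zpowers fun x => by
      obtain ⟨a, rfl⟩ := hg x
      exact Subgroup.npow_mem_zpowers g a
  obtain ⟨a, rfl⟩ := hg α
  simp only [isRrFree_pow_iff hr hR hk0 hcard ho]
  rw [← sum_divisors_moebius_ite_dvd hr hR]
  have hr0 : (r : ℂ) ≠ 0 := by exact_mod_cast hr.ne'
  calc _ = ∑ d ∈ (R * r).divisors, ∑ e ∈ R.divisors, if d ∣ r * e then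
        (ArithmeticFunction.moebius e : ℂ) / e / r *
          ∑ χ : MulChar F ℂ with orderOf χ = d, χ ((g ^ a : Fˣ) : F) else 0 := by
        rw [Finset.mul_sum]
        refine Finset.sum_congr rfl fun d hd => ?_
        have hdR : d / d.gcd r ∣ R :=
          (Nat.div_gcd_dvd_iff hr).2 (mul_comm R r ▸ Nat.dvd_of_mem_divisors hd)
        rw [← Finset.sum_filter, ← Finset.sum_mul, ← Finset.sum_div]
        simp only [← Nat.div_gcd_dvd_iff hr]
        rw [sum_divisors_moebius_div_of_dvd hR hdR]
        ring
    _ = _ := by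
        rw [Finset.sum_comm]
        refine Finset.sum_congr rfl fun e he => ?_
        obtain ⟨f, rfl⟩ := Nat.dvd_of_mem_divisors he
        have he0 : 0 < e := Nat.pos_of_mem_divisors he
        have hfk : 0 < f * k := Nat.mul_pos (pos_of_mul_pos_right hR (Nat.zero_le _)) hk0
        have hre : 0 < r * e := Nat.mul_pos hr he0
        have heC : (e : ℂ) ≠ 0 := by exact_mod_cast he0.ne'
        have hdiv : (e * f * r).divisors.filter (· ∣ r * e) = (r * e).divisors := by
          ext d
          simp only [Finset.mem_filter, Nat.mem_divisors]
          exact ⟨fun h => ⟨h.2, hre.ne'⟩, fun h => ⟨⟨h.1.trans ⟨f, by ring⟩,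
            (Nat.mul_pos hR hr).ne'⟩, h.1⟩⟩
        rw [← Finset.sum_filter, hdiv, ← Finset.mul_sum,
          MulChar.sum_divisors_sum_orderOf_eq hre,
          MulChar.sum_pow_eq_one (k := f * k) (by rw [hcard]; ring)]
        simp only [pow_pow_eq_one_iff_dvd hfk (ho.trans (by ring : _ = r * e * (f * k)))]
        split_ifs
        · push_cast
          field_simp
        · simp
end

section
/- Let q be a prime power and let h(y) ∈ F_q(y) be a nonzero rational function such that h cannot be written in the form ω · y^t · g(y)^s for any ω ∈ F_q^*, integer t, rational function g(y) ∈ F_q(y), and divisor s of q−1 with s > 1. Suppose y^{n₁} · h(y)^{n₂} = c · G(y)^{q−1} for some integers n₁, n₂ with 0 ≤ n₁, n₂ ≤ q−2, some c ∈ F_q^*, and some nonzero rational function G(y) ∈ F_q(y). Then n₁ = 0 and n₂ = 0. -/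
theorem RatFunc.intDegree_pow_eq_mul {K : Type*} [Field K] {x : RatFunc K} (hx : x ≠ 0) (n : ℕ) :
    (x ^ n).intDegree = n * x.intDegree := by
  induction n with
  | zero => simp
  | succ n ih =>
    rw [pow_succ, RatFunc.intDegree_mul (pow_ne_zero n hx) hx, ih]
    push_cast
    ring

/-- A rational function with a positive power equal to a nonzero constant is a nonzero constant. -/
theorem RatFunc.exists_eq_C_of_pow_eq_C {K : Type*} [Field K] {u : RatFunc K} {d : ℕ} (hd : 0 < d)
    {c : Kˣ} (hu : u ^ d = RatFunc.C (c : K)) : ∃ w : Kˣ, u = RatFunc.C (w : K) := by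
  have hint : IsIntegral (Polynomial K) (u ^ d) := by
    rw [hu, ← RatFunc.algebraMap_C]
    exact isIntegral_algebraMap
  obtain ⟨p, rfl⟩ := IsIntegrallyClosed.exists_algebraMap_eq_of_isIntegral_pow hd hint
  rw [← map_pow, ← RatFunc.algebraMap_C] at hu
  have hp : p ^ d = Polynomial.C (c : K) := RatFunc.algebraMap_injective K hu
  have hunit : IsUnit p := (isUnit_pow_iff hd.ne').1 (hp ▸ Polynomial.isUnit_C.2 c.isUnit)
  obtain ⟨r, ⟨w, rfl⟩, rfl⟩ := Polynomial.isUnit_iff.1 hunit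
  exact ⟨w, RatFunc.algebraMap_C _⟩


/-- Let `q` be a prime power and `h ∈ F_q(y)` a nonzero rational function that is not of the
form `ω · y^t · g(y)^s` for any `ω ∈ F_q^*`, integer `t`, `g ∈ F_q(y)` and divisor `s > 1` of
`q - 1`.  If `y^{n₁} · h^{n₂} = c · G^{q-1}` for some `0 ≤ n₁, n₂ ≤ q - 2`, some `c ∈ F_q^*`
and some nonzero `G ∈ F_q(y)`, then `n₁ = 0` and `n₂ = 0`. -/
theorem eq_zero_of_pow_mul_eq_card_sub_one_pow
    {F : Type*} [Field F] [Fintype F] {q : ℕ} (hq : Fintype.card F = q)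
    (h : RatFunc F) (hh : h ≠ 0)
    (hform : ¬ ∃ (ω : Fˣ) (t : ℤ) (g : RatFunc F) (s : ℕ),
      s ∣ q - 1 ∧ 1 < s ∧ h = RatFunc.C (ω : F) * RatFunc.X ^ t * g ^ s)
    (n₁ n₂ : ℕ) (hn₁ : n₁ ≤ q - 2) (hn₂ : n₂ ≤ q - 2)
    (c : Fˣ) (G : RatFunc F) (hG : G ≠ 0)
    (heq : RatFunc.X ^ n₁ * h ^ n₂ = RatFunc.C (c : F) * G ^ (q - 1)) :
    n₁ = 0 ∧ n₂ = 0 := by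
  have hX : (RatFunc.X : RatFunc F) ≠ 0 := RatFunc.X_ne_zero
  have hq2 : 2 ≤ q := hq ▸ Fintype.one_lt_card
  have hdeg : (n₁ : ℤ) + n₂ * h.intDegree = ((q - 1 : ℕ) : ℤ) * G.intDegree := by
    have hcong := congrArg RatFunc.intDegree heq
    rwa [RatFunc.intDegree_mul (pow_ne_zero _ hX) (pow_ne_zero _ hh),
      RatFunc.intDegree_mul (by simp) (pow_ne_zero _ hG), RatFunc.intDegree_pow_eq_mul hX,
      RatFunc.intDegree_pow_eq_mul hh, RatFunc.intDegree_pow_eq_mul hG, RatFunc.intDegree_X,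
      RatFunc.intDegree_C, mul_one, zero_add] at hcong
  rcases Nat.eq_zero_or_pos n₂ with rfl | hpos
  · refine ⟨Nat.eq_zero_of_dvd_of_lt (a := q - 1) ?_ (by omega), rfl⟩
    refine Int.natCast_dvd_natCast.1 ⟨G.intDegree, ?_⟩
    simpa using hdeg
  exfalso
  have hdpos : 0 < n₂.gcd (q - 1) := Nat.gcd_pos_of_pos_left _ hpos
  obtain ⟨m, s, hcop, hm, hs⟩ := Nat.exists_coprime n₂ (q - 1)
  set d := n₂.gcd (q - 1)
  have hs1 : 1 < s := by
    have hle : d ≤ n₂ := Nat.gcd_le_left _ hpos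
    by_contra! hcon
    have : s * d ≤ 1 * d := Nat.mul_le_mul_right _ hcon
    omega
  obtain ⟨k, hk⟩ : d ∣ n₁ := by
    refine Int.natCast_dvd_natCast.1 ⟨s * G.intDegree - m * h.intDegree, ?_⟩
    rw [hm, hs] at hdeg
    push_cast at hdeg
    linear_combination hdeg
  obtain ⟨w, hw⟩ := RatFunc.exists_eq_C_of_pow_eq_C (u := RatFunc.X ^ k * h ^ m / G ^ s) hdpos
    (c := c) (by
      rw [div_pow, mul_pow, ← pow_mul, ← pow_mul, ← pow_mul, mul_comm k, ← hk, ← hm, ← hs, heq,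
        mul_div_cancel_right₀ _ (pow_ne_zero _ hG)])
  have hhm : h ^ m = RatFunc.C (w : F) * RatFunc.X ^ (-k : ℤ) * G ^ s := by
    rw [div_eq_iff (pow_ne_zero _ hG)] at hw
    rw [zpow_neg, zpow_natCast, mul_right_comm, ← hw]
    field_simp
  have hbez : (m : ℤ) * m.gcdA s + s * m.gcdB s = 1 := by
    rw [← Nat.gcd_eq_gcd_ab, hcop.gcd_eq_one, Nat.cast_one]
  set a := m.gcdA s
  set b := m.gcdB s
  refine hform ⟨w ^ a, -k * a, G ^ a * h ^ b, s, ⟨d, hs⟩, hs1, ?_⟩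
  calc h = (h ^ m) ^ a * (h ^ b) ^ s := by
        rw [← zpow_natCast h m, ← zpow_natCast (h ^ b) s, ← zpow_mul, ← zpow_mul, ← zpow_add₀ hh,
          mul_comm b, hbez, zpow_one]
    _ = _ := by
        rw [hhm, mul_zpow, mul_zpow, ← zpow_mul, Units.val_zpow_eq_zpow_val, map_zpow₀, mul_pow,
          ← zpow_natCast G s, ← zpow_natCast (G ^ a) s, ← zpow_mul, ← zpow_mul, mul_comm a (s : ℤ),
          mul_assoc, mul_assoc]
end
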